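/- Let n ≥ 2 and s ≥ 1 be integers, let κ be a nonzero real number and b a real number. Define c_0 = 1 and, for 1 ≤ j ≤ n, c_j = Π_{l=0}^{j−1} ( (2(n + s − l) − 1)/κ ). Then ∫₀^b t^{n} J_{n+2s}(κt) dt = −Σ_{j=2}^{n} (c_{n−j}/κ) b^{j} J_{j+2s−1}(κb) − ( c_{n−1}/κ + c_n/(2s−1) ) · b J_{2s}(κb) − c_n Σ_{j=1}^{s−1} ( 4j/(4j² − 1) ) · b J_{2j}(κb) − c_n b J_0(κb) + c_n · ∫₀^b J_0(κt) dt. -/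

import Mathlib

open Real MeasureTheory

/-- Bessel function of the first kind of nonnegative integer order `m`. -/
noncomputable def besselJ (m : ℕ) (x : ℝ) : ℝ :=
  ∑' j : ℕ, ((-1 : ℝ) ^ j / ((j.factorial : ℝ) * ((j + m).factorial : ℝ))) * (x / 2) ^ (2 * j + m)

/-- The entire function `∑ (-y)^j / (j! (j+m)!)`, so that `J_m(x) = (x/2)^m * besselAux m ((x/2)^2)`. -/
noncomputable def besselAux (m : ℕ) (y : ℝ) : ℝ :=
  ∑' j : ℕ, ((-1 : ℝ) ^ j / ((j.factorial : ℝ) * ((j + m).factorial : ℝ))) * y ^ j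

theorem besselJ_eq_besselAux (m : ℕ) (x : ℝ) :
    besselJ m x = (x / 2) ^ m * besselAux m ((x / 2) ^ 2) := by
  unfold besselJ besselAux
  rw [← tsum_mul_left]
  refine tsum_congr fun j => ?_
  rw [pow_add, pow_mul]
  ring

theorem abs_besselAux_coeff_le (m j : ℕ) :
    |(-1 : ℝ) ^ j / ((j.factorial : ℝ) * ((j + m).factorial : ℝ))| ≤ 1 / (j.factorial : ℝ) := by
  have h1 : (0 : ℝ) < j.factorial := by exact_mod_cast j.factorial_pos
  have h2 : (1 : ℝ) ≤ (j + m).factorial := by exact_mod_cast (j + m).factorial_pos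
  rw [abs_div, abs_pow, abs_neg, abs_one, one_pow, abs_of_pos (by positivity)]
  exact one_div_le_one_div_of_le h1 (le_mul_of_one_le_right h1.le h2)

theorem summable_besselAux (m : ℕ) (y : ℝ) :
    Summable fun j : ℕ =>
      ((-1 : ℝ) ^ j / ((j.factorial : ℝ) * ((j + m).factorial : ℝ))) * y ^ j := by
  refine Summable.of_norm_bounded (Real.summable_pow_div_factorial |y|) fun j => ?_
  rw [norm_mul, norm_pow, Real.norm_eq_abs, Real.norm_eq_abs, ← one_div_mul_eq_div _ (|y| ^ j)]
  exact mul_le_mul_of_nonneg_right (abs_besselAux_coeff_le m j)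
    (pow_nonneg (abs_nonneg y) j)

theorem besselAux_coeff_succ (m j : ℕ) :
    ((-1 : ℝ) ^ (j + 1) / (((j + 1).factorial : ℝ) * ((j + 1 + m).factorial : ℝ))) *
      ((j + 1 : ℕ) : ℝ) =
    -((-1 : ℝ) ^ j / ((j.factorial : ℝ) * ((j + (m + 1)).factorial : ℝ))) := by
  rw [show j + 1 + m = j + (m + 1) by ring, Nat.factorial_succ j]
  have h1 : (j.factorial : ℝ) ≠ 0 := by exact_mod_cast j.factorial_ne_zero
  have h2 : ((j + (m + 1)).factorial : ℝ) ≠ 0 := by exact_mod_cast Nat.factorial_ne_zero _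
  have h3 : (j : ℝ) + 1 ≠ 0 := by positivity
  push_cast
  field_simp
  ring

theorem hasDerivAt_besselAux (m : ℕ) (y : ℝ) :
    HasDerivAt (besselAux m) (-besselAux (m + 1) y) y := by
  have hsum : Summable fun j : ℕ => 1 / (j.factorial : ℝ) * (j * (|y| + 1) ^ (j - 1)) := by
    rw [← summable_nat_add_iff 1]
    refine (Real.summable_pow_div_factorial (|y| + 1)).congr fun j => ?_
    have h1 : (j.factorial : ℝ) ≠ 0 := by exact_mod_cast j.factorial_ne_zero
    have h3 : (j : ℝ) + 1 ≠ 0 := by positivity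
    rw [Nat.factorial_succ, Nat.add_sub_cancel]
    push_cast
    field_simp
  have hbound : ∀ (j : ℕ) (z : ℝ), z ∈ Metric.ball (0 : ℝ) (|y| + 1) →
      ‖((-1 : ℝ) ^ j / ((j.factorial : ℝ) * ((j + m).factorial : ℝ))) * (j * z ^ (j - 1))‖ ≤
        1 / (j.factorial : ℝ) * (j * (|y| + 1) ^ (j - 1)) := by
    intro j z hz
    have hz' : |z| ≤ |y| + 1 := by
      simpa [Real.norm_eq_abs] using (mem_ball_zero_iff.mp hz).le
    rw [norm_mul, norm_mul, norm_pow, Real.norm_eq_abs, Real.norm_eq_abs, Real.norm_eq_abs,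
      Nat.abs_cast]
    have := abs_besselAux_coeff_le m j
    gcongr
  have hy : y ∈ Metric.ball (0 : ℝ) (|y| + 1) := by
    rw [mem_ball_zero_iff, Real.norm_eq_abs]
    linarith
  have hderiv := hasDerivAt_tsum_of_isPreconnected hsum Metric.isOpen_ball
    (convex_ball (0 : ℝ) (|y| + 1)).isPreconnected
    (fun j z _ => (hasDerivAt_pow j z).const_mul
      ((-1 : ℝ) ^ j / ((j.factorial : ℝ) * ((j + m).factorial : ℝ))))
    hbound hy (summable_besselAux m y) hy
  refine hderiv.congr_deriv (Eq.symm ?_)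
  have hs := Summable.of_norm_bounded hsum fun j => hbound j y hy
  rw [hs.tsum_eq_zero_add, besselAux, ← tsum_neg]
  simp only [Nat.cast_zero, zero_mul, mul_zero, zero_add, Nat.add_sub_cancel]
  refine tsum_congr fun j => ?_
  rw [← mul_assoc, besselAux_coeff_succ, neg_mul]

theorem besselAux_recurrence (m : ℕ) (y : ℝ) :
    besselAux m y = (m + 1) * besselAux (m + 1) y - y * besselAux (m + 2) y := by
  have h1 := summable_besselAux m y
  have h2 := summable_besselAux (m + 1) y
  have h3 := summable_besselAux (m + 2) y
  simp only [besselAux]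
  rw [h1.tsum_eq_zero_add, h2.tsum_eq_zero_add, mul_add, ← tsum_mul_left, ← tsum_mul_left,
    add_sub_assoc, ← Summable.tsum_sub (((summable_nat_add_iff 1).mpr h2).mul_left _)
      (h3.mul_left _)]
  congr 1
  · have : (m.factorial : ℝ) ≠ 0 := by exact_mod_cast m.factorial_ne_zero
    have h4 : (m : ℝ) + 1 ≠ 0 := by positivity
    simp only [zero_add, Nat.factorial_succ, Nat.factorial_zero]
    push_cast
    field_simp
  · refine tsum_congr fun j => ?_
    rw [show j + 1 + (m + 1) = j + m + 1 + 1 by ring, show j + (m + 2) = j + m + 1 + 1 by ring,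
      show j + 1 + m = j + m + 1 by ring, Nat.factorial_succ (j + m + 1), Nat.factorial_succ j]
    have h4 : (j.factorial : ℝ) ≠ 0 := by exact_mod_cast j.factorial_ne_zero
    have h5 : ((j + m + 1).factorial : ℝ) ≠ 0 := by exact_mod_cast Nat.factorial_ne_zero _
    have h6 : (j : ℝ) + 1 ≠ 0 := by positivity
    have h7 : (j : ℝ) + m + 1 + 1 ≠ 0 := by positivity
    push_cast
    field_simp
    ring

theorem hasDerivAt_besselAux_comp (m : ℕ) (κ t : ℝ) :
    HasDerivAt (fun t => besselAux m ((κ * t / 2) ^ 2))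
      (-besselAux (m + 1) ((κ * t / 2) ^ 2) * (κ ^ 2 * t / 2)) t := by
  have h : HasDerivAt (fun t : ℝ => (κ * t / 2) ^ 2) (κ ^ 2 * t / 2) t := by
    refine ((((hasDerivAt_id t).const_mul κ).div_const 2).pow 2).congr_deriv ?_
    simp only [id_eq, Nat.cast_ofNat]
    ring
  exact (hasDerivAt_besselAux m _).comp t h

theorem hasDerivAt_pow_mul_besselJ (k m : ℕ) (κ t : ℝ) :
    HasDerivAt (fun t => t ^ (k + 1) * besselJ m (κ * t))
      ((k + 1 + m) * (t ^ k * besselJ m (κ * t)) -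
        κ * (t ^ (k + 1) * besselJ (m + 1) (κ * t))) t := by
  have hfun : (fun t => t ^ (k + 1) * besselJ m (κ * t)) =
      fun t => (κ / 2) ^ m * t ^ (k + m + 1) * besselAux m ((κ * t / 2) ^ 2) := by
    funext u
    rw [besselJ_eq_besselAux]
    ring
  rw [hfun]
  refine (((hasDerivAt_pow (k + m + 1) t).const_mul ((κ / 2) ^ m)).mul
    (hasDerivAt_besselAux_comp m κ t)).congr_deriv (Eq.symm ?_)
  rw [besselJ_eq_besselAux, besselJ_eq_besselAux, Nat.add_sub_cancel]
  push_cast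
  ring

theorem hasDerivAt_besselJ_succ (m : ℕ) (κ t : ℝ) :
    HasDerivAt (fun t => besselJ (m + 1) (κ * t))
      (κ / 2 * (besselJ m (κ * t) - besselJ (m + 2) (κ * t))) t := by
  have hfun : (fun t => besselJ (m + 1) (κ * t)) =
      fun t => (κ / 2) ^ (m + 1) * t ^ (m + 1) * besselAux (m + 1) ((κ * t / 2) ^ 2) := by
    funext u
    rw [besselJ_eq_besselAux]
    ring
  rw [hfun]
  refine (((hasDerivAt_pow (m + 1) t).const_mul ((κ / 2) ^ (m + 1))).mul
    (hasDerivAt_besselAux_comp (m + 1) κ t)).congr_deriv (Eq.symm ?_)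
  rw [besselJ_eq_besselAux, besselJ_eq_besselAux, besselAux_recurrence m, Nat.add_sub_cancel]
  push_cast
  ring

theorem besselJ_recurrence (m : ℕ) (x : ℝ) :
    2 * (m + 1) * besselJ (m + 1) x = x * (besselJ m x + besselJ (m + 2) x) := by
  rw [besselJ_eq_besselAux, besselJ_eq_besselAux, besselJ_eq_besselAux, besselAux_recurrence m]
  ring

theorem continuous_besselJ_mul (m : ℕ) (κ : ℝ) : Continuous fun t => besselJ m (κ * t) := by
  have h : Continuous (besselAux m) :=
    continuous_iff_continuousAt.mpr fun y => (hasDerivAt_besselAux m y).continuousAt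
  simp only [besselJ_eq_besselAux]
  fun_prop

theorem integral_pow_succ_mul_besselJ (k m : ℕ) (κ b : ℝ) (hκ : κ ≠ 0) :
    ∫ t in (0:ℝ)..b, t ^ (k + 1) * besselJ (m + 1) (κ * t) =
      -(b ^ (k + 1) * besselJ m (κ * b)) / κ +
        (k + 1 + m) / κ * ∫ t in (0:ℝ)..b, t ^ k * besselJ m (κ * t) := by
  have c1 : Continuous fun t => t ^ k * besselJ m (κ * t) :=
    (continuous_pow k).mul (continuous_besselJ_mul m κ)
  have c2 : Continuous fun t => t ^ (k + 1) * besselJ (m + 1) (κ * t) :=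
    (continuous_pow _).mul (continuous_besselJ_mul _ κ)
  have h := intervalIntegral.integral_eq_sub_of_hasDerivAt (a := 0) (b := b)
    (fun t _ => hasDerivAt_pow_mul_besselJ k m κ t)
    (((c1.const_mul _).sub (c2.const_mul _)).intervalIntegrable 0 b)
  rw [intervalIntegral.integral_sub ((c1.const_mul _).intervalIntegrable 0 b)
    ((c2.const_mul _).intervalIntegrable 0 b), intervalIntegral.integral_const_mul,
    intervalIntegral.integral_const_mul, zero_pow k.succ_ne_zero, zero_mul, sub_zero] at h
  rw [← h]
  field_simp
  ring

theorem integral_besselJ_add_two (m : ℕ) (κ b : ℝ) (hκ : κ ≠ 0) :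
    ∫ t in (0:ℝ)..b, besselJ (m + 2) (κ * t) =
      (∫ t in (0:ℝ)..b, besselJ m (κ * t)) -
        b / (m + 1) * (besselJ m (κ * b) + besselJ (m + 2) (κ * b)) := by
  have c1 := continuous_besselJ_mul m κ
  have c2 := continuous_besselJ_mul (m + 2) κ
  have h := intervalIntegral.integral_eq_sub_of_hasDerivAt (a := 0) (b := b)
    (fun t _ => hasDerivAt_besselJ_succ m κ t)
    (((c1.sub c2).const_mul _).intervalIntegrable 0 b)
  have h0 : besselJ (m + 1) (κ * 0) = 0 := by simp [besselJ_eq_besselAux]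
  rw [intervalIntegral.integral_const_mul, intervalIntegral.integral_sub
    (c1.intervalIntegrable 0 b) (c2.intervalIntegrable 0 b), h0, sub_zero] at h
  have hr := besselJ_recurrence m (κ * b)
  rw [← h] at hr
  have hm : (m : ℝ) + 1 ≠ 0 := by positivity
  have hr' : (m + 1) * ((∫ t in (0:ℝ)..b, besselJ m (κ * t)) -
      ∫ t in (0:ℝ)..b, besselJ (m + 2) (κ * t)) =
      b * (besselJ m (κ * b) + besselJ (m + 2) (κ * b)) :=
    mul_left_cancel₀ hκ (by linear_combination hr)
  field_simp
  linear_combination -hr'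

theorem integral_besselJ_even (s : ℕ) (κ b : ℝ) (hκ : κ ≠ 0) :
    ∫ t in (0:ℝ)..b, besselJ (2 * (s + 1)) (κ * t) =
      -(b * besselJ (2 * (s + 1)) (κ * b) / (2 * s + 1)) -
        (∑ j ∈ Finset.Icc 1 s,
          (4 * (j : ℝ) / (4 * (j : ℝ) ^ 2 - 1)) * b * besselJ (2 * j) (κ * b)) -
        b * besselJ 0 (κ * b) + ∫ t in (0:ℝ)..b, besselJ 0 (κ * t) := by
  induction s with
  | zero =>
    have h := integral_besselJ_add_two 0 κ b hκ
    simp only [zero_add, mul_one, Finset.Icc_eq_empty_of_lt zero_lt_one, Finset.sum_empty,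
      Nat.cast_zero, mul_zero] at h ⊢
    rw [h]
    ring
  | succ s ih =>
    rw [show 2 * (s + 1 + 1) = 2 * (s + 1) + 2 by ring, integral_besselJ_add_two _ κ b hκ, ih,
      Finset.sum_Icc_succ_top (by omega)]
    have h1 : (2 : ℝ) * s + 1 ≠ 0 := by positivity
    have h2 : (2 : ℝ) * s + 3 ≠ 0 := by positivity
    have h3 : (4 : ℝ) * (s + 1) ^ 2 - 1 = (2 * s + 1) * (2 * s + 3) := by ring
    have h4 : (2 : ℝ) * (s + 1) + 1 = 2 * s + 3 := by ring
    push_cast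
    rw [h3, h4]
    field_simp
    ring

theorem integral_pow_mul_besselJ (n s : ℕ) (κ b : ℝ) (hκ : κ ≠ 0) (k : ℕ)
    (hk : k ≤ n) :
    ∫ t in (0:ℝ)..b, t ^ n * besselJ (n + 2 * s) (κ * t) =
      -(∑ j ∈ Finset.Ioc (n - k) n,
        ((∏ l ∈ Finset.range (n - j), ((2 * ((n : ℝ) + s - l) - 1) / κ)) / κ) * b ^ j *
          besselJ (j + 2 * s - 1) (κ * b)) +
        (∏ l ∈ Finset.range k, ((2 * ((n : ℝ) + s - l) - 1) / κ)) *
          ∫ t in (0:ℝ)..b, t ^ (n - k) * besselJ (n - k + 2 * s) (κ * t) := by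
  induction k with
  | zero => simp
  | succ k ih =>
    obtain ⟨p, rfl⟩ : ∃ p, n = p + k + 1 := ⟨n - (k + 1), by omega⟩
    rw [ih (by omega), show p + k + 1 - k = p + 1 by omega,
      show p + k + 1 - (k + 1) = p by omega, show p + 1 + 2 * s = p + 2 * s + 1 by ring,
      integral_pow_succ_mul_besselJ p (p + 2 * s) κ b hκ, Finset.prod_range_succ,
      ← Finset.insert_Ioc_add_one_left_eq_Ioc (show p < p + k + 1 by omega),
      Finset.sum_insert (by simp), show p + k + 1 - (p + 1) = k by omega,
      show p + 1 + 2 * s - 1 = p + 2 * s by omega]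
    push_cast
    ring

theorem stmt_14 (n s : ℕ) (hn : 2 ≤ n) (hs : 1 ≤ s) (κ b : ℝ) (hκ : κ ≠ 0) (c : ℕ → ℝ)
    (hc : ∀ j : ℕ, c j = ∏ l ∈ Finset.range j, ((2 * ((n : ℝ) + s - l) - 1) / κ)) :
    ∫ t in (0:ℝ)..b, t ^ n * besselJ (n + 2 * s) (κ * t) =
      -(∑ j ∈ Finset.Icc 2 n, (c (n - j) / κ) * b ^ j * besselJ (j + 2 * s - 1) (κ * b)) -
        (c (n - 1) / κ + c n / (2 * (s : ℝ) - 1)) * b * besselJ (2 * s) (κ * b) -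
        c n * (∑ j ∈ Finset.Icc 1 (s - 1),
          (4 * (j : ℝ) / (4 * (j : ℝ) ^ 2 - 1)) * b * besselJ (2 * j) (κ * b)) -
        c n * b * besselJ 0 (κ * b) +
        c n * ∫ t in (0:ℝ)..b, besselJ 0 (κ * t) := by
  have hIoc : Finset.Ioc 0 n = insert 1 (Finset.Icc 2 n) := by
    ext j
    simp only [Finset.mem_Ioc, Finset.mem_insert, Finset.mem_Icc]
    omega
  have h := integral_pow_mul_besselJ n s κ b hκ n le_rfl
  simp only [← hc, Nat.sub_self, pow_zero, one_mul, zero_add] at h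
  rw [hIoc, Finset.sum_insert (by simp), show 1 + 2 * s - 1 = 2 * s by omega] at h
  rw [h]
  obtain ⟨r, rfl⟩ : ∃ r, s = r + 1 := ⟨s - 1, by omega⟩
  rw [integral_besselJ_even r κ b hκ, Nat.add_sub_cancel]
  push_cast
  rw [show 2 * ((r : ℝ) + 1) - 1 = 2 * r + 1 by ring]
  ring
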